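/- There exists an absolute constant C > 0 with the following property. For every integer N ≥ 1 and every u ∈ (0, 1), if g is a standard normal random variable and ζ is a standard Gaussian vector in ℝ^N independent of g (so that T = √N g / ‖ζ‖ has the Student distribution with N degrees of freedom), then P( T > 1 + C ( log^{1/4}(1/u) + log^{1/2}(1/u) · exp( (2/N) log(1/u) ) ) ) ≤ u. Equivalently, the 1 − u quantile of the Student distribution with N degrees of freedom is at most 1 + C( log^{1/4}(1/u) + log^{1/2}(1/u) exp((2/N) log(1/u)) ). -/

import Mathlib

open MeasureTheory ProbabilityTheory

lemma sq_gauss_tail (a : ℝ) (ha : 0 ≤ a) :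
    gaussianReal 0 1 {x | a ≤ x} ≤ ENNReal.ofReal (Real.exp (-(a ^ 2 / 2))) := by
  have h := measure_ge_le_exp_mul_mgf (μ := gaussianReal 0 1) (X := id) a ha
    (by simpa using integrable_exp_mul_gaussianReal (μ := 0) (v := 1) a)
  rw [mgf_id_gaussianReal] at h
  rw [← ofReal_measureReal]
  apply ENNReal.ofReal_le_ofReal
  refine h.trans (le_of_eq ?_)
  simp only [← Real.exp_add]
  congr 1
  push_cast
  ring

lemma sq_gauss_int (b : ℝ) (hb : 0 ≤ b) :
    ∫ x, Real.exp (-b * x ^ 2) ∂(gaussianReal 0 1) = √(1 / (1 + 2 * b)) := by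
  rw [integral_gaussianReal_eq_integral_smul one_ne_zero]
  have : ∀ x : ℝ, gaussianPDFReal 0 1 x • Real.exp (-b * x ^ 2)
      = (√(2 * Real.pi))⁻¹ * Real.exp (-(b + 1 / 2) * x ^ 2) := by
    intro x
    simp only [gaussianPDFReal, smul_eq_mul, mul_assoc, ← Real.exp_add]
    simp
    ring_nf
    simp
  simp_rw [this]
  rw [integral_const_mul, integral_gaussian, ← Real.sqrt_inv, ← Real.sqrt_mul (by positivity)]
  congr 1
  have := Real.pi_pos
  field_simp
  ring

lemma sq_real (x : ℝ) (hx : 0 ≤ x) :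
    √(1 / (1 + 4 * x * Real.exp (4 * x))) ≤ Real.exp (-x) := by
  rw [Real.sqrt_le_iff]
  refine ⟨(Real.exp_pos _).le, ?_⟩
  have h1 : Real.exp (2 * x) ≤ 1 + 4 * x * Real.exp (4 * x) := by
    have h2 : 1 - 2 * x ≤ Real.exp (-(2 * x)) := by
      have := Real.add_one_le_exp (-(2 * x)); linarith
    have h3 : Real.exp (-(2 * x)) * Real.exp (2 * x) = 1 := by
      rw [← Real.exp_add]; simp
    have h4 : Real.exp (2 * x) ≤ Real.exp (4 * x) := Real.exp_le_exp.2 (by linarith)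
    have h5 := Real.exp_pos (2 * x)
    have h6 := mul_le_mul_of_nonneg_right h2 h5.le
    have h7 := mul_le_mul_of_nonneg_left h4 hx
    have h8 := mul_nonneg hx h5.le
    nlinarith
  have h9 : Real.exp (-x) ^ 2 = 1 / Real.exp (2 * x) := by
    rw [one_div, ← Real.exp_neg, ← Real.exp_nat_mul]; congr 1; push_cast; ring
  rw [h9]
  exact one_div_le_one_div_of_le (Real.exp_pos _) h1

lemma sq_prod (N : ℕ) (b : ℝ) (hb : 0 ≤ b) :
    ((gaussianReal 0 1).prod (Measure.pi (fun _ : Fin N => gaussianReal 0 1)))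
      {p : ℝ × (Fin N → ℝ) | √(2 * b * ∑ i, p.2 i ^ 2) ≤ p.1}
      ≤ ENNReal.ofReal (√(1 / (1 + 2 * b)) ^ N) := by
  have hm : MeasurableSet {p : ℝ × (Fin N → ℝ) | √(2 * b * ∑ i, p.2 i ^ 2) ≤ p.1} :=
    measurableSet_le (by fun_prop) (by fun_prop)
  rw [Measure.prod_apply_symm hm]
  have hint : Integrable (fun x : ℝ => Real.exp (-b * x ^ 2)) (gaussianReal 0 1) := by
    refine Integrable.of_bound (by fun_prop) 1 (ae_of_all _ fun x => ?_)
    rw [Real.norm_eq_abs, abs_of_pos (Real.exp_pos _), Real.exp_le_one_iff]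
    nlinarith [sq_nonneg x, mul_nonneg hb (sq_nonneg x)]
  have hI := Integrable.fintype_prod (ι := Fin N) (μ := fun _ => gaussianReal 0 1)
    (f := fun _ (x : ℝ) => Real.exp (-b * x ^ 2)) (fun _ => hint)
  have hE := integral_fintype_prod_eq_pow (ι := Fin N) (μ := gaussianReal 0 1)
    (fun x : ℝ => Real.exp (-b * x ^ 2))
  rw [sq_gauss_int b hb, Fintype.card_fin] at hE
  rw [← hE, ofReal_integral_eq_lintegral_ofReal hI
    (ae_of_all _ fun x => Finset.prod_nonneg fun i _ => (Real.exp_pos _).le)]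
  refine lintegral_mono fun z => ?_
  refine (sq_gauss_tail (√(2 * b * ∑ i, z i ^ 2)) (Real.sqrt_nonneg _)).trans (le_of_eq ?_)
  rw [Real.sq_sqrt (mul_nonneg (by linarith) (Finset.sum_nonneg fun i _ => sq_nonneg _)),
    ← Real.exp_sum, ← Finset.mul_sum]
  congr 2
  ring

/-- Inequality (46), Step 1 in the proof of Proposition 1: a bound on the quantiles of the
Student distribution with `N` degrees of freedom. There is an absolute constant `C > 0` such
that if `T = √N g / ‖ζ‖` with `g` standard normal independent of the standard Gaussian vector
`ζ` of `ℝ^N`, then `P(T > 1 + C(log^{1/4}(1/u) + log^{1/2}(1/u) exp((2/N) log(1/u)))) ≤ u`. -/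
theorem student_quantile_bound :
    ∃ C : ℝ, 0 < C ∧
      ∀ (N : ℕ), 1 ≤ N → ∀ u : ℝ, 0 < u → u < 1 →
        ∀ (Ω : Type) (mΩ : MeasurableSpace Ω) (P : Measure Ω), IsProbabilityMeasure P →
          ∀ (g : Ω → ℝ) (ζ : Ω → EuclideanSpace ℝ (Fin N)),
            Measure.map g P = gaussianReal 0 1 →
            Measure.map (fun ω i => ζ ω i) P = Measure.pi (fun _ : Fin N => gaussianReal 0 1) →
            IndepFun g (fun ω i => ζ ω i : Ω → Fin N → ℝ) P →
            P {ω | 1 + C * (Real.log (1 / u) ^ ((1 : ℝ) / 4)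
                  + Real.log (1 / u) ^ ((1 : ℝ) / 2)
                      * Real.exp ((2 / (N : ℝ)) * Real.log (1 / u)))
                < Real.sqrt (N : ℝ) * g ω / ‖ζ ω‖}
              ≤ ENNReal.ofReal u := by
  refine ⟨2, by norm_num, ?_⟩
  intro N hN u hu0 hu1 Ω mΩ P hP g ζ hg hζ hind
  have hgm : AEMeasurable g P := AEMeasurable.of_map_ne_zero (by
    rw [hg]; exact IsProbabilityMeasure.ne_zero _)
  have hζm : AEMeasurable (fun ω i => ζ ω i : Ω → Fin N → ℝ) P := AEMeasurable.of_map_ne_zero (by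
    rw [hζ]; exact IsProbabilityMeasure.ne_zero _)
  have hprod := (indepFun_iff_map_prod_eq_prod_map_map hgm hζm).1 hind
  rw [hg, hζ] at hprod
  set L := Real.log (1 / u) with hL
  have hL0 : 0 ≤ L := Real.log_nonneg (by rw [le_div_iff₀ hu0]; linarith)
  have hNpos : (0 : ℝ) < N := by exact_mod_cast hN
  set x := L / N with hx
  have hx0 : 0 ≤ x := by positivity
  set b := 2 * x * Real.exp (4 * x) with hb
  have hb0 : 0 ≤ b := by positivity
  have hu : Real.exp (-x) ^ N = u := by
    rw [← Real.exp_nat_mul, hx, mul_neg, mul_div_cancel₀ _ hNpos.ne', hL, one_div, Real.log_inv,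
      neg_neg, Real.exp_log hu0]
  set t := 2 * (L ^ ((1 : ℝ) / 2) * Real.exp ((2 / (N : ℝ)) * L)) with ht
  have ht0 : 0 ≤ t := by positivity
  have ht2 : t ^ 2 = N * (2 * b) := by
    rw [ht, mul_pow, mul_pow, ← Real.sqrt_eq_rpow, Real.sq_sqrt hL0, ← Real.exp_nat_mul, hb]
    have h1 : ((2 : ℕ) : ℝ) * (2 / (N : ℝ) * L) = 4 * x := by rw [hx]; push_cast; ring
    have h2 : L = N * x := by rw [hx]; field_simp
    rw [h1]
    nth_rewrite 1 [h2]
    ring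
  calc _ ≤ P ((fun ω => (g ω, fun i => ζ ω i)) ⁻¹'
        {p : ℝ × (Fin N → ℝ) | √(2 * b * ∑ i, p.2 i ^ 2) ≤ p.1}) := by
        refine measure_mono fun ω hω => ?_
        simp only [Set.mem_ofPred_eq, Set.mem_preimage] at hω ⊢
        have hq : 0 ≤ L ^ ((1 : ℝ) / 4) := by positivity
        have hlt : t < √(N : ℝ) * g ω / ‖ζ ω‖ := lt_of_le_of_lt (by rw [ht]; linarith) hω
        have hpos : 0 < ‖ζ ω‖ := by
          rcases (norm_nonneg (ζ ω)).eq_or_lt with h | h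
          · rw [← h, div_zero] at hlt; linarith
          · exact h
        rw [lt_div_iff₀ hpos] at hlt
        have hsN : 0 < √(N : ℝ) := Real.sqrt_pos.2 hNpos
        have htz : 0 ≤ t * ‖ζ ω‖ := by positivity
        have hg0 : 0 < g ω := by
          by_contra hc
          nlinarith [mul_nonneg hsN.le (neg_nonneg.2 (not_lt.1 hc))]
        rw [Real.sqrt_le_iff]
        refine ⟨hg0.le, ?_⟩
        have hsq := pow_le_pow_left₀ htz hlt.le 2
        rw [mul_pow t, mul_pow (√(N : ℝ)), ht2, Real.sq_sqrt hNpos.le, EuclideanSpace.real_norm_sq_eq,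
          mul_assoc] at hsq
        exact le_of_mul_le_mul_left hsq hNpos
    _ ≤ (P.map (fun ω => (g ω, fun i => ζ ω i)))
        {p : ℝ × (Fin N → ℝ) | √(2 * b * ∑ i, p.2 i ^ 2) ≤ p.1} :=
        Measure.le_map_apply (hgm.prodMk hζm) _
    _ ≤ ENNReal.ofReal (√(1 / (1 + 2 * b)) ^ N) := by
        rw [hprod]; exact sq_prod N b hb0
    _ ≤ ENNReal.ofReal u := by
        apply ENNReal.ofReal_le_ofReal
        rw [← hu]
        refine pow_le_pow_left₀ (Real.sqrt_nonneg _) ?_ N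
        have := sq_real x hx0
        rwa [show 4 * x * Real.exp (4 * x) = 2 * b by rw [hb]; ring] at this
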